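/- Let Ω, Σ be non-isotropic weights on ℝ^N built from weight functions ω_1,…,ω_N, σ_1,…,σ_N, and let f, g ∈ S_Ω^Σ(ℝ^N). Then the short-time Fourier transform V_g f, as a function on ℝ^{2N}, belongs to S_{Ω⊕Σ}^{Σ⊕Ω}(ℝ^{2N}), where (Ω⊕Σ)(x,ξ) = Ω(x) + Σ(ξ) and (Σ⊕Ω)(y,η) = Σ(y) + Ω(η), i.e. V_g f lies in the space on ℝ^{2N} built from the 2N weight functions ω_1,…,ω_N,σ_1,…,σ_N on the time side and σ_1,…,σ_N,ω_1,…,ω_N on the Fourier side. -/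

import Mathlib

open MeasureTheory Filter
open scoped ENNReal NNReal

noncomputable section

/-- Euclidean pairing `x·ξ = ∑ x_j ξ_j`. -/
def dotR {M : ℕ} (x ξ : Fin M → ℝ) : ℝ := ∑ j, x j * ξ j

/-- Fourier transform with kernel `e^{-i x·ξ}`. -/
def FT {M : ℕ} (f : (Fin M → ℝ) → ℂ) (ξ : Fin M → ℝ) : ℂ :=
  ∫ x, Complex.exp (-(Complex.I * (dotR x ξ : ℂ))) * f x

/-- sup-norm (in `ℝ≥0∞`) of a complex-valued function. -/
def supNorm {M : ℕ} (f : (Fin M → ℝ) → ℂ) : ℝ≥0∞ := ⨆ x, (‖f x‖₊ : ℝ≥0∞)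

/-- partial derivative `∂_j`. -/
def pD {M : ℕ} (j : Fin M) (f : (Fin M → ℝ) → ℂ) : (Fin M → ℝ) → ℂ :=
  fun x => fderiv ℝ f x (Pi.single j 1)

/-- iterated partial derivative `∂^α`. -/
def pDpow {M : ℕ} (α : Fin M → ℕ) (f : (Fin M → ℝ) → ℂ) : (Fin M → ℝ) → ℂ :=
  ((List.ofFn fun j : Fin M => (pD j)^[α j]).foldr (· ∘ ·) id) f

/-- `D^α = (-i)^{|α|} ∂^α`. -/
def Dpow {M : ℕ} (α : Fin M → ℕ) (f : (Fin M → ℝ) → ℂ) : (Fin M → ℝ) → ℂ :=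
  fun x => (-Complex.I) ^ (∑ j, α j) * pDpow α f x

/-- multiplication by the monomial `x^α`. -/
def monMul {M : ℕ} (α : Fin M → ℕ) (f : (Fin M → ℝ) → ℂ) : (Fin M → ℝ) → ℂ :=
  fun x => ((∏ j, (x j) ^ (α j) : ℝ) : ℂ) * f x

/-- Weight function in the sense of the paper (extended to `ℝ` by `ω x = ω |x|`):
continuous, increasing on `[0,∞)`, nonnegative, together with conditions
(α), (β), (γ), (δ). -/
structure IsWeightFun (ω : ℝ → ℝ) : Prop where
  nonneg : ∀ x, 0 ≤ ω x
  eq_abs : ∀ x, ω x = ω |x|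
  continuous : Continuous ω
  mono : MonotoneOn ω (Set.Ici 0)
  alphaCond : ∃ K, 1 ≤ K ∧ ∀ x, 0 ≤ x → ω (2 * x) ≤ K * (1 + ω x)
  betaCond : Filter.Tendsto (fun x => ω x / x) Filter.atTop (nhds 0)
  gammaCond : ∃ a b : ℝ, 0 < b ∧ ∀ x, 0 ≤ x → a + b * Real.log (1 + x) ≤ ω x
  deltaCond : ConvexOn ℝ (Set.Ici 0) fun t => ω (Real.exp t)

/-- non-isotropic weight `Ω(x) = ω_1(x_1) + ⋯ + ω_M(x_M)`. -/
def wSum {M : ℕ} (ω : Fin M → ℝ → ℝ) (x : Fin M → ℝ) : ℝ := ∑ j, ω j (x j)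

/-- Membership in the space `S_Ω^Σ(ℝ^M)`: `f ∈ L¹`, `f` and `f̂` smooth, and for
every `λ > 0` and every multi-index `α`, `‖e^{λΩ} D^α f‖_∞ < ∞` and
`‖e^{λΣ} D^α f̂‖_∞ < ∞`. -/
structure MemS {M : ℕ} (Om Sig : (Fin M → ℝ) → ℝ) (f : (Fin M → ℝ) → ℂ) : Prop where
  integrable : Integrable f
  smooth : ContDiff ℝ (⊤ : ℕ∞) f
  smooth_ft : ContDiff ℝ (⊤ : ℕ∞) (FT f)
  decay : ∀ lam : ℝ, 0 < lam → ∀ α : Fin M → ℕ,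
      supNorm (fun x => (Real.exp (lam * Om x) : ℂ) * Dpow α f x) < ⊤
  decay_ft : ∀ lam : ℝ, 0 < lam → ∀ α : Fin M → ℕ,
      supNorm (fun ξ => (Real.exp (lam * Sig ξ) : ℂ) * Dpow α (FT f) ξ) < ⊤

/-- short-time Fourier transform `V_g f(x,ξ) = ∫ e^{-i t·ξ} f(t) conj (g(t-x)) dt`. -/
def STFT {M : ℕ} (g f : (Fin M → ℝ) → ℂ) (x ξ : Fin M → ℝ) : ℂ :=
  ∫ t, Complex.exp (-(Complex.I * (dotR t ξ : ℂ))) * f t * (starRingEnd ℂ) (g (t - x))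

/-- first block of variables of `z ∈ ℝ^{2N}`. -/
def firstB {N : ℕ} (z : Fin (N + N) → ℝ) : Fin N → ℝ := fun j => z (Fin.castAdd N j)

/-- second block of variables of `z ∈ ℝ^{2N}`. -/
def secondB {N : ℕ} (z : Fin (N + N) → ℝ) : Fin N → ℝ := fun j => z (Fin.natAdd N j)

/-- The properties of a weight on `ℝ^M` that the decay estimates rely on. -/
structure TameWeight {M : ℕ} (W : (Fin M → ℝ) → ℝ) : Prop where
  nonneg : ∀ x, 0 ≤ W x
  even : ∀ x, W (-x) = W x
  continuous : Continuous W
  quasiSubadditive : ∃ K, 0 ≤ K ∧ ∀ x y, W (x + y) ≤ K * (1 + W x + W y)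
  norm_le_exp : ∃ C b : ℝ, 0 ≤ C ∧ 0 ≤ b ∧ ∀ x, 1 + ‖x‖ ≤ C * Real.exp (b * W x)

lemma IsWeightFun.quasiSubadditive {ω : ℝ → ℝ} (h : IsWeightFun ω) :
    ∃ K, 0 ≤ K ∧ ∀ x y, ω (x + y) ≤ K * (1 + ω x + ω y) := by
  obtain ⟨K, hK, hα⟩ := h.alphaCond
  refine ⟨K, by linarith, fun x y => ?_⟩
  have key : ω (x + y) ≤ ω (2 * max |x| |y|) := by
    rw [h.eq_abs (x + y)]
    refine h.mono (Set.mem_Ici.2 (abs_nonneg _)) (by simp) ?_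
    calc |x + y| ≤ |x| + |y| := abs_add_le x y
      _ ≤ 2 * max |x| |y| := by linarith [le_max_left |x| |y|, le_max_right |x| |y|]
  have hmax : ω (max |x| |y|) ≤ ω x + ω y := by
    rcases max_choice |x| |y| with hm | hm <;> rw [hm, ← h.eq_abs]
    · linarith [h.nonneg y]
    · linarith [h.nonneg x]
  calc ω (x + y) ≤ K * (1 + ω (max |x| |y|)) := key.trans (hα _ (by simp))
    _ ≤ K * (1 + ω x + ω y) := by
      apply mul_le_mul_of_nonneg_left _ (by linarith); linarith

lemma IsWeightFun.abs_le_exp {ω : ℝ → ℝ} (h : IsWeightFun ω) :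
    ∃ C b : ℝ, 0 ≤ C ∧ 0 ≤ b ∧ ∀ x, |x| ≤ C * Real.exp (b * ω x) := by
  obtain ⟨a, b, hb, hγ⟩ := h.gammaCond
  refine ⟨Real.exp (-a / b), 1 / b, (Real.exp_pos _).le, by positivity, fun x => ?_⟩
  have h1 := hγ |x| (abs_nonneg x)
  rw [← h.eq_abs] at h1
  have hpos : 0 < 1 + |x| := by positivity
  have h2 : Real.log (1 + |x|) ≤ -a / b + 1 / b * ω x := by
    rw [show -a / b + 1 / b * ω x = (ω x - a) / b by ring, le_div_iff₀ hb]
    linarith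
  have h3 := (Real.log_le_iff_le_exp hpos).1 h2
  rw [← Real.exp_add]
  linarith

lemma tameWeight_wSum {M : ℕ} {ω : Fin M → ℝ → ℝ} (hω : ∀ j, IsWeightFun (ω j)) :
    TameWeight (wSum ω) where
  nonneg x := Finset.sum_nonneg fun j _ => (hω j).nonneg _
  even x := Finset.sum_congr rfl fun j _ => by
    rw [(hω j).eq_abs, Pi.neg_apply, abs_neg, ← (hω j).eq_abs]
  continuous := continuous_finsetSum _ fun j _ => (hω j).continuous.comp (continuous_apply j)
  quasiSubadditive := by
    choose K hK0 hK using fun j => (hω j).quasiSubadditive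
    refine ⟨∑ j, K j, Finset.sum_nonneg fun j _ => hK0 j, fun x y => ?_⟩
    rw [Finset.sum_mul]
    refine Finset.sum_le_sum fun j _ => (hK j _ _).trans
      (mul_le_mul_of_nonneg_left ?_ (hK0 j))
    have hle : ∀ z : Fin M → ℝ, ω j (z j) ≤ wSum ω z := fun z =>
      Finset.single_le_sum (f := fun j => ω j (z j)) (fun i _ => (hω i).nonneg _)
        (Finset.mem_univ j)
    linarith [hle x, hle y]
  norm_le_exp := by
    choose C b hC hb h using fun j => (hω j).abs_le_exp
    have hB : 0 ≤ ∑ j, b j := Finset.sum_nonneg fun j _ => hb j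
    refine ⟨1 + ∑ j, C j, ∑ j, b j, add_nonneg zero_le_one (Finset.sum_nonneg fun j _ => hC j),
      hB, fun x => ?_⟩
    have hW : 0 ≤ wSum ω x := Finset.sum_nonneg fun j _ => (hω j).nonneg _
    have hnorm : ‖x‖ ≤ ∑ j, |x j| :=
      (pi_norm_le_iff_of_nonneg (Finset.sum_nonneg fun j _ => abs_nonneg _)).2 fun i =>
        Finset.single_le_sum (f := fun j => |x j|) (fun j _ => abs_nonneg _) (Finset.mem_univ i)
    have h1 : 1 ≤ Real.exp ((∑ j, b j) * wSum ω x) := Real.one_le_exp (by positivity)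
    have h2 : ∑ j, |x j| ≤ (∑ j, C j) * Real.exp ((∑ j, b j) * wSum ω x) := by
      rw [Finset.sum_mul]
      refine Finset.sum_le_sum fun j _ => (h j _).trans
        (mul_le_mul_of_nonneg_left (Real.exp_le_exp.2 ?_) (hC j))
      exact mul_le_mul (Finset.single_le_sum (fun i _ => hb i) (Finset.mem_univ j))
        (Finset.single_le_sum (f := fun j => ω j (x j)) (fun i _ => (hω i).nonneg _)
          (Finset.mem_univ j)) ((hω j).nonneg _) hB
    rw [add_mul, one_mul]
    linarith

lemma continuous_firstB {N : ℕ} : Continuous (firstB (N := N)) := by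
  unfold firstB; fun_prop

lemma continuous_secondB {N : ℕ} : Continuous (secondB (N := N)) := by
  unfold secondB; fun_prop

lemma norm_le_norm_firstB_add_norm_secondB {N : ℕ} (z : Fin (N + N) → ℝ) :
    ‖z‖ ≤ ‖firstB z‖ + ‖secondB z‖ := by
  refine (pi_norm_le_iff_of_nonneg (by positivity)).2 fun i => ?_
  induction i using Fin.addCases with
  | left i => exact (norm_le_pi_norm (firstB z) i).trans (le_add_of_nonneg_right (norm_nonneg _))
  | right i => exact (norm_le_pi_norm (secondB z) i).trans (le_add_of_nonneg_left (norm_nonneg _))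

lemma TameWeight.directSum {N : ℕ} {U V : (Fin N → ℝ) → ℝ} (hU : TameWeight U)
    (hV : TameWeight V) :
    TameWeight fun z : Fin (N + N) → ℝ => U (firstB z) + V (secondB z) where
  nonneg z := add_nonneg (hU.nonneg _) (hV.nonneg _)
  even z := congrArg₂ (· + ·) (hU.even (firstB z)) (hV.even (secondB z))
  continuous := (hU.continuous.comp continuous_firstB).add (hV.continuous.comp continuous_secondB)
  quasiSubadditive := by
    obtain ⟨K, hK0, hK⟩ := hU.quasiSubadditive
    obtain ⟨L, hL0, hL⟩ := hV.quasiSubadditive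
    refine ⟨K + L, add_nonneg hK0 hL0, fun x y => ?_⟩
    rw [add_mul]
    have hx1 := hU.nonneg (firstB x)
    have hx2 := hV.nonneg (secondB x)
    have hy1 := hU.nonneg (firstB y)
    have hy2 := hV.nonneg (secondB y)
    exact add_le_add
      ((hK (firstB x) (firstB y)).trans (mul_le_mul_of_nonneg_left (by linarith) hK0))
      ((hL (secondB x) (secondB y)).trans (mul_le_mul_of_nonneg_left (by linarith) hL0))
  norm_le_exp := by
    obtain ⟨C, b, hC, hb, h⟩ := hU.norm_le_exp
    obtain ⟨C', b', hC', hb', h'⟩ := hV.norm_le_exp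
    refine ⟨C + C', b + b', add_nonneg hC hC', add_nonneg hb hb', fun z => ?_⟩
    have hu := hU.nonneg (firstB z)
    have hv := hV.nonneg (secondB z)
    have h1 := (h (firstB z)).trans (mul_le_mul_of_nonneg_left (Real.exp_le_exp.2
      (show b * U (firstB z) ≤ (b + b') * (U (firstB z) + V (secondB z)) by nlinarith)) hC)
    have h2 := (h' (secondB z)).trans (mul_le_mul_of_nonneg_left (Real.exp_le_exp.2
      (show b' * V (secondB z) ≤ (b + b') * (U (firstB z) + V (secondB z)) by nlinarith)) hC')
    rw [add_mul]
    linarith [norm_le_norm_firstB_add_norm_secondB z]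

/-- `h` decays faster than every power of `e^{-W}`. -/
def ExpDecay {M : ℕ} (W : (Fin M → ℝ) → ℝ) (h : (Fin M → ℝ) → ℂ) : Prop :=
  ∀ lam : ℝ, 0 ≤ lam → ∃ C, 0 ≤ C ∧ ∀ x, ‖h x‖ ≤ C * Real.exp (-(lam * W x))

lemma ExpDecay.of_supNorm {M : ℕ} {W : (Fin M → ℝ) → ℝ} {h : (Fin M → ℝ) → ℂ}
    (hW : ∀ x, 0 ≤ W x)
    (H : ∀ lam : ℝ, 0 < lam → supNorm (fun x => (Real.exp (lam * W x) : ℂ) * h x) < ⊤) :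
    ExpDecay W h := by
  intro lam hlam
  have hfin := H (lam + 1) (by linarith)
  refine ⟨_, ENNReal.toReal_nonneg (a := supNorm fun x =>
    (Real.exp ((lam + 1) * W x) : ℂ) * h x), fun x => ?_⟩
  have h1 : (‖(Real.exp ((lam + 1) * W x) : ℂ) * h x‖₊ : ℝ≥0∞) ≤
      supNorm fun x => (Real.exp ((lam + 1) * W x) : ℂ) * h x :=
    le_iSup (fun x => (‖(Real.exp ((lam + 1) * W x) : ℂ) * h x‖₊ : ℝ≥0∞)) x
  have h2 := ENNReal.toReal_mono hfin.ne h1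
  rw [ENNReal.coe_toReal, coe_nnnorm, norm_mul, Complex.norm_real, Real.norm_eq_abs,
    Real.abs_exp] at h2
  rw [Real.exp_neg, ← div_eq_mul_inv, le_div_iff₀ (Real.exp_pos _), mul_comm]
  refine le_trans (mul_le_mul_of_nonneg_right (Real.exp_le_exp.2 ?_) (norm_nonneg _)) h2
  nlinarith [hW x]

lemma ExpDecay.supNorm_lt_top {M : ℕ} {W : (Fin M → ℝ) → ℝ} {h : (Fin M → ℝ) → ℂ}
    (H : ExpDecay W h) {lam : ℝ} (hlam : 0 ≤ lam) {c : ℂ} :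
    supNorm (fun x => (Real.exp (lam * W x) : ℂ) * (c * h x)) < ⊤ := by
  obtain ⟨C, hC, h1⟩ := H lam hlam
  refine (iSup_le fun x => ?_).trans_lt (ENNReal.coe_lt_top (r := (‖c‖ * C).toNNReal))
  rw [ENNReal.coe_le_coe, ← NNReal.coe_le_coe, Real.coe_toNNReal _ (by positivity), coe_nnnorm,
    norm_mul, Complex.norm_real, Real.norm_eq_abs, Real.abs_exp, norm_mul]
  calc Real.exp (lam * W x) * (‖c‖ * ‖h x‖)
      ≤ Real.exp (lam * W x) * (‖c‖ * (C * Real.exp (-(lam * W x)))) := by gcongr; exact h1 x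
    _ = ‖c‖ * C * (Real.exp (lam * W x) * Real.exp (-(lam * W x))) := by ring
    _ = ‖c‖ * C := by rw [← Real.exp_add]; simp

lemma ExpDecay.polynomial {M : ℕ} {W : (Fin M → ℝ) → ℝ} {h : (Fin M → ℝ) → ℂ}
    (hW : TameWeight W) (H : ExpDecay W h) (n : ℕ) {lam : ℝ} (hlam : 0 ≤ lam) :
    ∃ C, 0 ≤ C ∧ ∀ x, (1 + ‖x‖) ^ n * ‖h x‖ ≤ C * Real.exp (-(lam * W x)) := by
  obtain ⟨C, b, hC, hb, hCb⟩ := hW.norm_le_exp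
  obtain ⟨C', hC', h1⟩ := H (n * b + lam) (by positivity)
  refine ⟨C ^ n * C', by positivity, fun x => ?_⟩
  calc (1 + ‖x‖) ^ n * ‖h x‖
      ≤ (C * Real.exp (b * W x)) ^ n * (C' * Real.exp (-((n * b + lam) * W x))) := by
        gcongr
        exacts [hCb x, h1 x]
    _ = C ^ n * C' * (Real.exp (n * (b * W x)) * Real.exp (-((n * b + lam) * W x))) := by
        rw [mul_pow, ← Real.exp_nat_mul]; ring
    _ = C ^ n * C' * Real.exp (-(lam * W x)) := by
        rw [← Real.exp_add]; congr 2; ring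

lemma integrable_one_add_norm_pow_inv (M : ℕ) :
    Integrable fun x : Fin M → ℝ => ((1 + ‖x‖) ^ (M + 1))⁻¹ := by
  have := integrable_one_add_norm (E := Fin M → ℝ) (μ := volume) (r := (M + 1 : ℕ)) (by simp)
  refine this.congr (ae_of_all _ fun x => ?_)
  simp only
  rw [Real.rpow_neg (by positivity), Real.rpow_natCast]

lemma ExpDecay.integrable_pow_mul {M : ℕ} {W : (Fin M → ℝ) → ℝ} {h : (Fin M → ℝ) → ℂ}
    (hW : TameWeight W) (H : ExpDecay W h) (hc : Continuous h) (n : ℕ) :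
    Integrable fun x => ‖x‖ ^ n * ‖h x‖ := by
  obtain ⟨C, hC, h1⟩ := H.polynomial hW (n + (M + 1)) le_rfl
  refine ((integrable_one_add_norm_pow_inv M).const_mul C).mono'
    (by fun_prop) (ae_of_all _ fun x => ?_)
  have h2 := h1 x
  rw [zero_mul, neg_zero, Real.exp_zero, mul_one, pow_add] at h2
  rw [Real.norm_of_nonneg (by positivity), ← div_eq_mul_inv, le_div_iff₀ (by positivity)]
  refine le_trans ?_ h2
  calc ‖x‖ ^ n * ‖h x‖ * (1 + ‖x‖) ^ (M + 1)
      ≤ (1 + ‖x‖) ^ n * ‖h x‖ * (1 + ‖x‖) ^ (M + 1) := by gcongr; linarith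
    _ = _ := by ring

lemma ExpDecay.integrable {M : ℕ} {W : (Fin M → ℝ) → ℝ} {h : (Fin M → ℝ) → ℂ}
    (hW : TameWeight W) (H : ExpDecay W h) (hc : Continuous h) : Integrable h := by
  refine (integrable_norm_iff hc.aestronglyMeasurable).1 ?_
  simpa using H.integrable_pow_mul hW hc 0

/-- Correlations of functions of rapid decay decay rapidly. -/
lemma ExpDecay.integral_norm_mul_norm_sub_le {M : ℕ} {W : (Fin M → ℝ) → ℝ}
    {u v : (Fin M → ℝ) → ℂ} (hW : TameWeight W) (hu : ExpDecay W u) (hv : ExpDecay W v)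
    {lam : ℝ} (hlam : 0 ≤ lam) :
    ∃ C, 0 ≤ C ∧ ∀ x, ∫ t, ‖u t‖ * ‖v (t - x)‖ ≤ C * Real.exp (-(lam * W x)) := by
  obtain ⟨K, hK, hsub⟩ := hW.quasiSubadditive
  obtain ⟨A, hA, h1⟩ := hu.polynomial hW (M + 1) (lam := lam * K) (by positivity)
  obtain ⟨B, hB, h2⟩ := hv (lam * K) (by positivity)
  have hint := integrable_one_add_norm_pow_inv M
  set J := ∫ t : Fin M → ℝ, ((1 + ‖t‖) ^ (M + 1))⁻¹
  have hJ : 0 ≤ J := integral_nonneg fun t => by positivity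
  refine ⟨A * B * Real.exp (lam * K) * J, by positivity, fun x => ?_⟩
  have hpt : ∀ t, ‖u t‖ * ‖v (t - x)‖ ≤
      (A * B * Real.exp (lam * K) * Real.exp (-(lam * W x))) * ((1 + ‖t‖) ^ (M + 1))⁻¹ := by
    intro t
    have hu' : ‖u t‖ ≤ A * Real.exp (-(lam * K * W t)) * ((1 + ‖t‖) ^ (M + 1))⁻¹ := by
      rw [← div_eq_mul_inv, le_div_iff₀ (by positivity), mul_comm]
      exact h1 t
    have hx : W x ≤ K * (1 + W t + W (t - x)) := by
      have := hsub t (-(t - x))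
      rwa [hW.even, add_neg_eq_iff_eq_add.2 (by abel : t = x + (t - x))] at this
    have hexp : Real.exp (-(lam * K * W t)) * Real.exp (-(lam * K * W (t - x))) ≤
        Real.exp (lam * K) * Real.exp (-(lam * W x)) := by
      rw [← Real.exp_add, ← Real.exp_add, Real.exp_le_exp]
      nlinarith [mul_le_mul_of_nonneg_left hx hlam]
    calc ‖u t‖ * ‖v (t - x)‖
        ≤ (A * Real.exp (-(lam * K * W t)) * ((1 + ‖t‖) ^ (M + 1))⁻¹) *
          (B * Real.exp (-(lam * K * W (t - x)))) := by gcongr; exact h2 _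
      _ = A * B * ((1 + ‖t‖) ^ (M + 1))⁻¹ *
          (Real.exp (-(lam * K * W t)) * Real.exp (-(lam * K * W (t - x)))) := by ring
      _ ≤ A * B * ((1 + ‖t‖) ^ (M + 1))⁻¹ * (Real.exp (lam * K) * Real.exp (-(lam * W x))) := by
          gcongr
      _ = _ := by ring
  calc ∫ t, ‖u t‖ * ‖v (t - x)‖
      ≤ ∫ t, (A * B * Real.exp (lam * K) * Real.exp (-(lam * W x))) *
          ((1 + ‖t‖) ^ (M + 1))⁻¹ :=
        integral_mono_of_nonneg (ae_of_all _ fun t => by positivity) (hint.const_mul _)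
          (ae_of_all _ hpt)
    _ = A * B * Real.exp (lam * K) * J * Real.exp (-(lam * W x)) := by
        rw [integral_const_mul]; ring

/-- Smooth functions all of whose derivatives are bounded. -/
structure SmoothBounded {M : ℕ} (h : (Fin M → ℝ) → ℂ) : Prop where
  contDiff : ContDiff ℝ (⊤ : ℕ∞) h
  bounded : ∀ n : ℕ, ∃ C, ∀ x, ‖iteratedFDeriv ℝ n h x‖ ≤ C

lemma SmoothBounded.pD {M : ℕ} {h : (Fin M → ℝ) → ℂ} (H : SmoothBounded h) (j : Fin M) :
    SmoothBounded (pD j h) := by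
  have hd : ContDiff ℝ (⊤ : ℕ∞) (fderiv ℝ h) := H.contDiff.fderiv_right (by simp)
  refine ⟨hd.clm_apply contDiff_const, fun n => ?_⟩
  obtain ⟨C, hC⟩ := H.bounded (n + 1)
  refine ⟨‖(Pi.single j 1 : Fin M → ℝ)‖ * C, fun x => ?_⟩
  refine (norm_iteratedFDeriv_clm_apply_const hd.contDiffAt
    (by exact_mod_cast le_top)).trans ?_
  rw [norm_iteratedFDeriv_fderiv]
  exact mul_le_mul_of_nonneg_left (hC x) (norm_nonneg _)

lemma SmoothBounded.norm_sub_sub_le {M : ℕ} {h : (Fin M → ℝ) → ℂ} (H : SmoothBounded h) :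
    ∃ B, 0 ≤ B ∧ ∀ x y, ‖h y - h x - fderiv ℝ h x (y - x)‖ ≤ B * ‖y - x‖ * ‖y - x‖ := by
  obtain ⟨B, hB⟩ := H.bounded 2
  have hd : ContDiff ℝ (⊤ : ℕ∞) (fderiv ℝ h) := H.contDiff.fderiv_right (by simp)
  have hB0 : 0 ≤ B := (norm_nonneg _).trans (hB 0)
  have hB' : ∀ x, ‖fderiv ℝ (fderiv ℝ h) x‖ ≤ B := fun x => by
    rw [← norm_iteratedFDeriv_one, norm_iteratedFDeriv_fderiv]
    exact hB x
  refine ⟨B, hB0, fun x y => ?_⟩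
  refine Convex.norm_image_sub_le_of_norm_fderiv_le' (𝕜 := ℝ) (s := segment ℝ x y)
    (fun z _ => (H.contDiff.differentiable (by simp)).differentiableAt) (fun z hz => ?_)
    (convex_segment x y) (left_mem_segment ℝ x y) (right_mem_segment ℝ x y)
  have := convex_univ.norm_image_sub_le_of_norm_fderiv_le (𝕜 := ℝ) (f := fderiv ℝ h)
    (fun z _ => (hd.differentiable (by simp)).differentiableAt) (fun z _ => hB' z)
    (Set.mem_univ x) (Set.mem_univ z)
  refine this.trans (mul_le_mul_of_nonneg_left ?_ hB0)
  exact norm_sub_le_of_mem_segment hz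

/-- Landau-type interpolation: decay of a function with bounded second derivatives passes to its
first derivatives. -/
lemma ExpDecay.pD {M : ℕ} {W : (Fin M → ℝ) → ℝ} {h : (Fin M → ℝ) → ℂ} (hW : TameWeight W)
    (H : ExpDecay W h) (hs : SmoothBounded h) (j : Fin M) : ExpDecay W (pD j h) := by
  intro lam hlam
  obtain ⟨B, hB, htaylor⟩ := hs.norm_sub_sub_le
  obtain ⟨K, hK, hsub⟩ := hW.quasiSubadditive
  obtain ⟨D, hD⟩ := (isCompact_closedBall (0 : Fin M → ℝ) 1).exists_bound_of_continuousOn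
    hW.continuous.continuousOn
  have hD0 : 0 ≤ D := (norm_nonneg _).trans (hD 0 (by simp))
  obtain ⟨A, hA, h1⟩ := H (2 * lam) (by positivity)
  obtain ⟨A', hA', h2⟩ := H (2 * lam * K) (by positivity)
  refine ⟨A' * Real.exp (2 * lam * K * (1 + D)) + A + B, by positivity, fun x => ?_⟩
  set s := Real.exp (-(lam * W x)) with hs_def
  have hs0 : 0 < s := Real.exp_pos _
  have hs1 : s ≤ 1 := Real.exp_le_one_iff.2 (by have := hW.nonneg x; nlinarith)
  have hss : Real.exp (-(2 * lam * W x)) = s * s := by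
    rw [hs_def, ← Real.exp_add]; congr 1; ring
  set e : Fin M → ℝ := Pi.single j 1
  have he : ‖e‖ = 1 := by simp [e, Pi.norm_single]
  have hse : ‖s • e‖ = s := by rw [norm_smul, he, Real.norm_of_nonneg hs0.le, mul_one]
  have hx : ‖h x‖ ≤ A * (s * s) := hss ▸ h1 x
  have hy : ‖h (x + s • e)‖ ≤ A' * Real.exp (2 * lam * K * (1 + D)) * (s * s) := by
    have hWx : W x ≤ K * (1 + W (x + s • e) + D) := by
      have h3 := hsub (x + s • e) (-(s • e))
      rw [add_neg_cancel_right, hW.even] at h3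
      have h4 := (le_abs_self _).trans (hD (s • e) (by simp [hse, hs1]))
      exact h3.trans (mul_le_mul_of_nonneg_left (by linarith) hK)
    refine (h2 _).trans ?_
    rw [mul_assoc A']
    refine mul_le_mul_of_nonneg_left ?_ hA'
    rw [← hss, ← Real.exp_add, Real.exp_le_exp]
    nlinarith [mul_le_mul_of_nonneg_left hWx hlam]
  have ht := htaylor x (x + s • e)
  rw [add_sub_cancel_left, hse, map_smul] at ht
  have hmain : s * ‖fderiv ℝ h x e‖ ≤
      (A' * Real.exp (2 * lam * K * (1 + D)) + A + B) * s * s := by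
    calc s * ‖fderiv ℝ h x e‖ = ‖s • fderiv ℝ h x e‖ := by
          rw [norm_smul, Real.norm_of_nonneg hs0.le]
      _ = ‖h (x + s • e) - h x - (h (x + s • e) - h x - s • fderiv ℝ h x e)‖ := by
          congr 1; abel
      _ ≤ ‖h (x + s • e)‖ + ‖h x‖ + ‖h (x + s • e) - h x - s • fderiv ℝ h x e‖ :=
          (norm_sub_le _ _).trans (add_le_add_left (norm_sub_le _ _) _)
      _ ≤ A' * Real.exp (2 * lam * K * (1 + D)) * (s * s) + A * (s * s) + B * s * s :=
          add_le_add (add_le_add hy hx) ht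
      _ = _ := by ring
  refine le_of_mul_le_mul_left ?_ hs0
  calc s * ‖_root_.pD j h x‖ ≤ _ := hmain
    _ = _ := by ring

lemma SmoothBounded.expDecay_pDpow {M : ℕ} {W : (Fin M → ℝ) → ℝ} {h : (Fin M → ℝ) → ℂ}
    (hW : TameWeight W) (H : ExpDecay W h) (hs : SmoothBounded h) (α : Fin M → ℕ) :
    ExpDecay W (pDpow α h) := by
  have hiter : ∀ (j : Fin M) (n : ℕ) (u : (Fin M → ℝ) → ℂ), SmoothBounded u ∧ ExpDecay W u →
      SmoothBounded ((_root_.pD j)^[n] u) ∧ ExpDecay W ((_root_.pD j)^[n] u) := by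
    intro j n
    induction n with
    | zero => exact fun u hu => hu
    | succ n ih => exact fun u hu => ih _ ⟨hu.1.pD j, hu.2.pD hW hu.1 j⟩
  have hfold : ∀ L : List (((Fin M → ℝ) → ℂ) → (Fin M → ℝ) → ℂ),
      (∀ T ∈ L, ∀ u, SmoothBounded u ∧ ExpDecay W u → SmoothBounded (T u) ∧ ExpDecay W (T u)) →
      SmoothBounded (L.foldr (· ∘ ·) id h) ∧ ExpDecay W (L.foldr (· ∘ ·) id h) := by
    intro L
    induction L with
    | nil => exact fun _ => ⟨hs, H⟩
    | cons T L ih =>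
      intro hL
      exact hL T (by simp) _ (ih fun T' hT' => hL T' (by simp [hT']))
  refine (hfold _ fun T hT => ?_).2
  obtain ⟨j, rfl⟩ := List.mem_ofFn.1 hT
  exact hiter j (α j)

lemma dotR_comm {M : ℕ} (x y : Fin M → ℝ) : dotR x y = dotR y x :=
  Finset.sum_congr rfl fun _ _ => mul_comm _ _

lemma dotR_neg_left {M : ℕ} (x y : Fin M → ℝ) : dotR (-x) y = -dotR x y := by
  simp [dotR]

lemma dotR_neg_right {M : ℕ} (x y : Fin M → ℝ) : dotR x (-y) = -dotR x y := by
  simp [dotR]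

lemma dotR_add_left {M : ℕ} (x y z : Fin M → ℝ) : dotR (x + y) z = dotR x z + dotR y z := by
  simp [dotR, add_mul, Finset.sum_add_distrib]

lemma dotR_add_right {M : ℕ} (x y z : Fin M → ℝ) : dotR x (y + z) = dotR x y + dotR x z := by
  simp [dotR, mul_add, Finset.sum_add_distrib]

lemma dotR_split {N : ℕ} (z w : Fin (N + N) → ℝ) :
    dotR z w = dotR (firstB z) (firstB w) + dotR (secondB z) (secondB w) := by
  simp [dotR, firstB, secondB, Fin.sum_univ_add]

lemma norm_cexp_I_mul (r : ℝ) : ‖Complex.exp (Complex.I * r)‖ = 1 := by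
  rw [mul_comm, Complex.norm_exp_ofReal_mul_I]

lemma norm_cexp_neg_I_mul (r : ℝ) : ‖Complex.exp (-(Complex.I * r))‖ = 1 := by
  simpa using norm_cexp_I_mul (-r)

/-- The pairing `(x, ξ) ↦ x·ξ / 2π` as a continuous bilinear map. -/
def dotCLM (M : ℕ) : (Fin M → ℝ) →L[ℝ] (Fin M → ℝ) →L[ℝ] ℝ :=
  (2 * Real.pi)⁻¹ • ∑ j : Fin M,
    (ContinuousLinearMap.mul ℝ ℝ).bilinearComp
      (ContinuousLinearMap.proj j) (ContinuousLinearMap.proj j)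

lemma dotCLM_apply {M : ℕ} (x ξ : Fin M → ℝ) : dotCLM M x ξ = (2 * Real.pi)⁻¹ * dotR x ξ := by
  simp [dotCLM, dotR]

lemma FT_eq_fourierIntegral {M : ℕ} (f : (Fin M → ℝ) → ℂ) :
    FT f = VectorFourier.fourierIntegral Real.fourierChar volume (dotCLM M).toLinearMap₁₂ f := by
  ext ξ
  refine integral_congr_ae (ae_of_all _ fun x => ?_)
  simp only [ContinuousLinearMap.toLinearMap₁₂_apply_apply_apply, dotCLM_apply, Circle.smul_def,
    Real.fourierChar_apply, smul_eq_mul]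
  congr 2
  push_cast
  have : (Real.pi : ℂ) ≠ 0 := by exact_mod_cast Real.pi_ne_zero
  field_simp

/-- The Fourier transform of a function of rapid decay is smooth with bounded derivatives. -/
lemma ExpDecay.smoothBounded_FT {M : ℕ} {W : (Fin M → ℝ) → ℝ} {h : (Fin M → ℝ) → ℂ}
    (hW : TameWeight W) (H : ExpDecay W h) (hc : Continuous h) : SmoothBounded (FT h) := by
  rw [FT_eq_fourierIntegral]
  refine ⟨VectorFourier.contDiff_fourierIntegral _ fun n _ => H.integrable_pow_mul hW hc n,
    fun n => ?_⟩
  have := fun ξ => VectorFourier.pow_mul_norm_iteratedFDeriv_fourierIntegral_le (μ := volume)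
    (dotCLM M) (f := h) (K := ⊤) (N := 0) (n := 0) (k := n) (contDiff_zero.2 hc)
    (fun k m _ hm => by
      obtain rfl : m = 0 := by simpa using hm
      simpa using H.integrable_pow_mul hW hc k) le_top (by simp) 0 ξ
  simp only [pow_zero, one_mul] at this
  exact ⟨_, this⟩

lemma FT_eq_fourier {M : ℕ} (f : (Fin M → ℝ) → ℂ) (w : EuclideanSpace ℝ (Fin M)) :
    FourierTransform.fourier (fun v : EuclideanSpace ℝ (Fin M) => f v.ofLp) w =
      FT f ((2 * Real.pi) • w.ofLp) := by
  rw [Real.fourier_eq', FT, ← (PiLp.volume_preserving_ofLp (Fin M)).integral_comp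
    (MeasurableEquiv.toLp 2 _).symm.measurableEmbedding]
  refine integral_congr_ae (ae_of_all _ fun v => ?_)
  simp only [smul_eq_mul]
  congr 2
  simp only [PiLp.inner_apply, dotR, RCLike.inner_apply, conj_trivial, Pi.smul_apply, smul_eq_mul]
  push_cast
  rw [Finset.mul_sum, Finset.sum_mul, Finset.mul_sum, ← Finset.sum_neg_distrib]
  refine Finset.sum_congr rfl fun j _ => ?_
  ring

/-- Fourier inversion for the transform `FT`. -/
lemma integral_cexp_mul_FT {M : ℕ} {f : (Fin M → ℝ) → ℂ} (hc : Continuous f)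
    (hf : Integrable f) (hF : Integrable (FT f)) (x : Fin M → ℝ) :
    ∫ ξ, Complex.exp (Complex.I * (dotR x ξ : ℂ)) * FT f ξ = (2 * Real.pi : ℂ) ^ M * f x := by
  have hemb := (MeasurableEquiv.toLp 2 (Fin M → ℝ)).symm.measurableEmbedding
  have hmp := PiLp.volume_preserving_ofLp (Fin M)
  have hpi : (2 * Real.pi) ≠ 0 := by positivity
  have hinv := Continuous.fourierInv_fourier_eq (V := EuclideanSpace ℝ (Fin M))
    (f := fun v => f v.ofLp) (by fun_prop) ((hmp.integrable_comp_emb hemb).2 hf) (by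
      simp_rw [funext (FT_eq_fourier f)]
      exact (hmp.integrable_comp_emb hemb (g := fun ξ => FT f ((2 * Real.pi) • ξ))).2
        (hF.comp_smul hpi))
  have h1 := congrFun hinv (WithLp.toLp 2 x)
  simp only [Real.fourierInv_eq', FT_eq_fourier] at h1
  rw [← h1]
  have h2 := Measure.integral_comp_smul (volume : Measure (Fin M → ℝ))
    (fun ξ => Complex.exp (Complex.I * (dotR x ξ : ℂ)) * FT f ξ) (2 * Real.pi)
  rw [← hmp.integral_comp hemb] at h2
  have h3 : ∀ v : EuclideanSpace ℝ (Fin M),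
      Complex.exp (↑(2 * Real.pi * inner ℝ v (WithLp.toLp 2 x)) * Complex.I) •
        FT f ((2 * Real.pi) • v.ofLp) =
      Complex.exp (Complex.I * (dotR x ((2 * Real.pi) • v.ofLp) : ℂ)) *
        FT f ((2 * Real.pi) • v.ofLp) := by
    intro v
    rw [smul_eq_mul]
    congr 2
    rw [mul_comm]
    congr 2
    simp only [PiLp.inner_apply, dotR, RCLike.inner_apply, conj_trivial, Pi.smul_apply,
      smul_eq_mul, Finset.mul_sum]
    exact Finset.sum_congr rfl fun j _ => by ring
  simp_rw [h3, h2, Module.finrank_fin_fun]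
  rw [abs_of_pos (by positivity), Complex.real_smul]
  push_cast
  rw [← mul_assoc, mul_inv_cancel₀ (by exact_mod_cast pow_ne_zero M hpi), one_mul]

/-- The splitting `ℝ^{2N} ≃ ℝ^N × ℝ^N`. -/
def blockEquiv (N : ℕ) : (Fin (N + N) → ℝ) ≃ᵐ (Fin N → ℝ) × (Fin N → ℝ) :=
  (MeasurableEquiv.piCongrLeft (fun _ => ℝ) finSumFinEquiv).symm.trans
    (MeasurableEquiv.sumPiEquivProdPi fun _ => ℝ)

lemma measurePreserving_blockEquiv (N : ℕ) : MeasurePreserving (blockEquiv N) :=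
  (volume_measurePreserving_piCongrLeft (fun _ => ℝ) finSumFinEquiv).symm.trans
    (volume_measurePreserving_sumPiEquivProdPi fun _ => ℝ)

lemma integral_blocks {N : ℕ} (h : (Fin N → ℝ) → (Fin N → ℝ) → ℂ) :
    ∫ z : Fin (N + N) → ℝ, h (firstB z) (secondB z) =
      ∫ p : (Fin N → ℝ) × (Fin N → ℝ), h p.1 p.2 :=
  (measurePreserving_blockEquiv N).integral_comp (blockEquiv N).measurableEmbedding
    fun p => h p.1 p.2

lemma FT_FT {M : ℕ} {h : (Fin M → ℝ) → ℂ} (hc : Continuous h) (hh : Integrable h)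
    (hF : Integrable (FT h)) (w : Fin M → ℝ) :
    FT (FT h) w = (2 * Real.pi : ℂ) ^ M * h (-w) := by
  rw [← integral_cexp_mul_FT hc hh hF, FT]
  simp only [dotR_neg_left, Complex.ofReal_neg, mul_neg, dotR_comm w]

lemma ExpDecay.comp_neg {M : ℕ} {W : (Fin M → ℝ) → ℝ} {h : (Fin M → ℝ) → ℂ}
    (hW : TameWeight W) (H : ExpDecay W h) : ExpDecay W fun x => h (-x) := by
  intro lam hlam
  obtain ⟨C, hC, h1⟩ := H lam hlam
  exact ⟨C, hC, fun x => by simpa only [hW.even] using h1 (-x)⟩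

lemma ExpDecay.const_mul {M : ℕ} {W : (Fin M → ℝ) → ℝ} {h : (Fin M → ℝ) → ℂ}
    (H : ExpDecay W h) (c : ℂ) : ExpDecay W fun x => c * h x := by
  intro lam hlam
  obtain ⟨C, hC, h1⟩ := H lam hlam
  refine ⟨‖c‖ * C, by positivity, fun x => ?_⟩
  rw [norm_mul, mul_assoc]
  exact mul_le_mul_of_nonneg_left (h1 x) (norm_nonneg c)

lemma Dpow_zero {M : ℕ} (f : (Fin M → ℝ) → ℂ) : Dpow 0 f = f := by
  have hfold : ∀ L : List (((Fin M → ℝ) → ℂ) → (Fin M → ℝ) → ℂ), (∀ T ∈ L, T = id) →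
      L.foldr (· ∘ ·) id f = f := by
    intro L
    induction L with
    | nil => exact fun _ => rfl
    | cons T L ih =>
      intro hL
      rw [List.foldr_cons, hL T (by simp)]
      exact ih fun T' hT' => hL T' (by simp [hT'])
  have hp : pDpow 0 f = f := hfold _ fun T hT => by
    obtain ⟨j, rfl⟩ := List.mem_ofFn.1 hT
    rfl
  ext x
  simp [Dpow, hp]

/-- The function on phase space whose Fourier transform is `V_g f`. -/
def stftSymbol {N : ℕ} (g f : (Fin N → ℝ) → ℂ) (z : Fin (N + N) → ℝ) : ℂ :=
  ((2 * Real.pi : ℂ) ^ N)⁻¹ * (Complex.exp (Complex.I * (dotR (secondB z) (firstB z) : ℂ)) *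
    (f (secondB z) * (starRingEnd ℂ) (FT g (-firstB z))))

lemma continuous_dotR {X : Type*} [TopologicalSpace X] {M : ℕ} {u v : X → Fin M → ℝ}
    (hu : Continuous u) (hv : Continuous v) : Continuous fun x => dotR (u x) (v x) := by
  unfold dotR; fun_prop

lemma continuous_stftSymbol {N : ℕ} {g f : (Fin N → ℝ) → ℂ} (hf : Continuous f)
    (hg : Continuous (FT g)) : Continuous (stftSymbol g f) := by
  have h1 := continuous_firstB (N := N)
  have h2 := continuous_secondB (N := N)
  have h3 := continuous_dotR h2 h1
  unfold stftSymbol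
  fun_prop

lemma ExpDecay.stftSymbol {N : ℕ} {U V : (Fin N → ℝ) → ℝ} {g f : (Fin N → ℝ) → ℂ}
    (hV : TameWeight V) (hf : ExpDecay U f) (hg : ExpDecay V (FT g)) :
    ExpDecay (fun z : Fin (N + N) → ℝ => V (firstB z) + U (secondB z)) (stftSymbol g f) := by
  refine ExpDecay.const_mul (fun lam hlam => ?_) _
  obtain ⟨A, hA, h1⟩ := hf lam hlam
  obtain ⟨B, hB, h2⟩ := hg.comp_neg hV lam hlam
  refine ⟨A * B, by positivity, fun z => ?_⟩
  rw [norm_mul, norm_cexp_I_mul, one_mul, norm_mul, RCLike.norm_conj]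
  calc ‖f (secondB z)‖ * ‖FT g (-firstB z)‖
      ≤ (A * Real.exp (-(lam * U (secondB z)))) * (B * Real.exp (-(lam * V (firstB z)))) := by
        gcongr
        exacts [h1 _, h2 _]
    _ = A * B * Real.exp (-(lam * (V (firstB z) + U (secondB z)))) := by
        rw [mul_mul_mul_comm, ← Real.exp_add]; congr 2; ring

/-- The integrand of the Fourier transform of `stftSymbol g f`, in block coordinates. -/
def stftKernel {N : ℕ} (g f : (Fin N → ℝ) → ℂ) (x ξ y η : Fin N → ℝ) : ℂ :=
  Complex.exp (-(Complex.I * (dotR y x + dotR η ξ : ℝ))) *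
    (((2 * Real.pi : ℂ) ^ N)⁻¹ * (Complex.exp (Complex.I * (dotR η y : ℂ)) *
      (f η * (starRingEnd ℂ) (FT g (-y)))))

lemma FT_stftSymbol_eq_integral_prod {N : ℕ} (g f : (Fin N → ℝ) → ℂ) (z : Fin (N + N) → ℝ) :
    FT (stftSymbol g f) z = ∫ p : (Fin N → ℝ) × (Fin N → ℝ),
      stftKernel g f (firstB z) (secondB z) p.1 p.2 := by
  rw [← integral_blocks, FT]
  simp only [dotR_split _ z]
  rfl

lemma integrable_stftKernel {N : ℕ} {g f : (Fin N → ℝ) → ℂ} (hf : Continuous f)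
    (hf' : Integrable f) (hg : Continuous (FT g)) (hg' : Integrable (FT g)) (x ξ : Fin N → ℝ) :
    Integrable fun p : (Fin N → ℝ) × (Fin N → ℝ) => stftKernel g f x ξ p.1 p.2 := by
  have hprod := ((hg'.comp_neg).mul_prod hf').norm.const_mul ‖((2 * Real.pi : ℂ) ^ N)⁻¹‖
  have hcont : Continuous fun p : (Fin N → ℝ) × (Fin N → ℝ) => stftKernel g f x ξ p.1 p.2 := by
    have h1 := continuous_dotR (continuous_snd (X := Fin N → ℝ) (Y := Fin N → ℝ)) continuous_fst
    have h2 := continuous_dotR (continuous_fst (X := Fin N → ℝ) (Y := Fin N → ℝ))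
      (continuous_const (y := x))
    have h3 := continuous_dotR (continuous_snd (X := Fin N → ℝ) (Y := Fin N → ℝ))
      (continuous_const (y := ξ))
    unfold stftKernel
    fun_prop
  refine hprod.mono' hcont.aestronglyMeasurable (ae_of_all _ fun p => le_of_eq ?_)
  rw [stftKernel, norm_mul, norm_cexp_neg_I_mul, one_mul, norm_mul, norm_mul, norm_cexp_I_mul,
    one_mul, norm_mul, RCLike.norm_conj, norm_mul, mul_comm ‖f p.2‖]

/-- `V_g f` is the Fourier transform of `stftSymbol g f`. -/
lemma FT_stftSymbol {N : ℕ} {g f : (Fin N → ℝ) → ℂ} (hf : Continuous f) (hf' : Integrable f)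
    (hg : Continuous g) (hg' : Integrable g) (hG : Continuous (FT g)) (hG' : Integrable (FT g))
    (z : Fin (N + N) → ℝ) :
    FT (stftSymbol g f) z = STFT g f (firstB z) (secondB z) := by
  rw [FT_stftSymbol_eq_integral_prod]
  have hint := integrable_stftKernel hf hf' hG hG' (firstB z) (secondB z)
  set x := firstB z
  set ξ := secondB z
  rw [Measure.volume_eq_prod] at hint ⊢
  rw [integral_prod_symm _ hint, STFT]
  refine integral_congr_ae (ae_of_all _ fun η => ?_)
  have hinv : ∫ y, (starRingEnd ℂ) (Complex.exp (Complex.I * (dotR (η - x) y : ℂ)) * FT g y) =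
      (2 * Real.pi : ℂ) ^ N * (starRingEnd ℂ) (g (η - x)) := by
    rw [integral_conj, integral_cexp_mul_FT hg hg' hG']
    rw [map_mul, map_pow, map_mul, Complex.conj_ofReal, Complex.conj_ofNat]
  rw [← integral_neg_eq_self] at hinv
  have hpt : ∀ y, stftKernel g f x ξ y η =
      (((2 * Real.pi : ℂ) ^ N)⁻¹ * (Complex.exp (-(Complex.I * (dotR η ξ : ℂ))) * f η)) *
        (starRingEnd ℂ) (Complex.exp (Complex.I * (dotR (η - x) (-y) : ℂ)) * FT g (-y)) := by
    intro y
    have hexp : Complex.exp (-(Complex.I * (dotR y x + dotR η ξ : ℝ))) *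
        Complex.exp (Complex.I * (dotR η y : ℂ)) =
        Complex.exp (-(Complex.I * (dotR η ξ : ℂ))) *
          (starRingEnd ℂ) (Complex.exp (Complex.I * (dotR (η - x) (-y) : ℂ))) := by
      rw [← Complex.exp_conj, ← Complex.exp_add, ← Complex.exp_add, map_mul, Complex.conj_I,
        Complex.conj_ofReal, sub_eq_add_neg, dotR_add_left, dotR_neg_left, dotR_neg_right,
        dotR_neg_right, dotR_comm x y]
      congr 1
      push_cast
      ring
    rw [map_mul, stftKernel]
    linear_combination (((2 * Real.pi : ℂ) ^ N)⁻¹ * f η * (starRingEnd ℂ) (FT g (-y))) * hexp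
  simp only [hpt]
  rw [integral_const_mul, hinv]
  have hpi : ((2 * Real.pi : ℂ) ^ N) ≠ 0 :=
    pow_ne_zero _ (mul_ne_zero two_ne_zero (by exact_mod_cast Real.pi_ne_zero))
  field_simp

lemma norm_STFT_le_time {N : ℕ} (g f : (Fin N → ℝ) → ℂ) (x ξ : Fin N → ℝ) :
    ‖STFT g f x ξ‖ ≤ ∫ t, ‖f t‖ * ‖g (t - x)‖ := by
  refine (norm_integral_le_integral_norm _).trans_eq (integral_congr_ae (ae_of_all _ fun t => ?_))
  simp only
  rw [norm_mul, norm_mul, norm_cexp_neg_I_mul, one_mul, RCLike.norm_conj]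

lemma norm_FT_stftSymbol_le_frequency {N : ℕ} {g f : (Fin N → ℝ) → ℂ} (hf : Continuous f)
    (hf' : Integrable f) (hg : Continuous (FT g)) (hg' : Integrable (FT g))
    (z : Fin (N + N) → ℝ) :
    ‖FT (stftSymbol g f) z‖ ≤
      ‖((2 * Real.pi : ℂ) ^ N)⁻¹‖ * ∫ y, ‖FT g (-y)‖ * ‖FT f (-(y - secondB z))‖ := by
  rw [FT_stftSymbol_eq_integral_prod]
  have hint := integrable_stftKernel hf hf' hg hg' (firstB z) (secondB z)
  set x := firstB z
  set ξ := secondB z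
  rw [Measure.volume_eq_prod] at hint ⊢
  rw [integral_prod _ hint, ← integral_const_mul]
  refine (norm_integral_le_integral_norm _).trans_eq (integral_congr_ae (ae_of_all _ fun y => ?_))
  have hpt : ∀ η, stftKernel g f x ξ y η =
      (((2 * Real.pi : ℂ) ^ N)⁻¹ * (Complex.exp (-(Complex.I * (dotR y x : ℂ))) *
        (starRingEnd ℂ) (FT g (-y)))) *
        (Complex.exp (-(Complex.I * (dotR η (-(y - ξ)) : ℂ))) * f η) := by
    intro η
    have hexp : Complex.exp (-(Complex.I * (dotR y x + dotR η ξ : ℝ))) *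
        Complex.exp (Complex.I * (dotR η y : ℂ)) =
        Complex.exp (-(Complex.I * (dotR y x : ℂ))) *
          Complex.exp (-(Complex.I * (dotR η (-(y - ξ)) : ℂ))) := by
      rw [← Complex.exp_add, ← Complex.exp_add, neg_sub, sub_eq_add_neg, dotR_add_right,
        dotR_neg_right]
      congr 1
      push_cast
      ring
    rw [stftKernel]
    linear_combination (((2 * Real.pi : ℂ) ^ N)⁻¹ * f η * (starRingEnd ℂ) (FT g (-y))) * hexp
  simp only [hpt]
  rw [integral_const_mul, norm_mul, norm_mul, norm_mul, norm_cexp_neg_I_mul, one_mul,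
    RCLike.norm_conj, mul_assoc]
  rfl

lemma ExpDecay.directSum {N : ℕ} {U V : (Fin N → ℝ) → ℝ} {F : (Fin (N + N) → ℝ) → ℂ}
    (hU : ExpDecay (fun z => U (firstB z)) F) (hV : ExpDecay (fun z => V (secondB z)) F) :
    ExpDecay (fun z => U (firstB z) + V (secondB z)) F := by
  intro lam hlam
  obtain ⟨A, hA, h1⟩ := hU (2 * lam) (by positivity)
  obtain ⟨B, hB, h2⟩ := hV (2 * lam) (by positivity)
  refine ⟨A + B, by positivity, fun z => ?_⟩
  set E := Real.exp (-(lam * (U (firstB z) + V (secondB z))))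
  have hE : 0 < E := Real.exp_pos _
  rcases le_total (V (secondB z)) (U (firstB z)) with h | h
  · have : Real.exp (-(2 * lam * U (firstB z))) ≤ E := Real.exp_le_exp.2 (by nlinarith)
    nlinarith [h1 z, mul_le_mul_of_nonneg_left this hA]
  · have : Real.exp (-(2 * lam * V (secondB z))) ≤ E := Real.exp_le_exp.2 (by nlinarith)
    nlinarith [h2 z, mul_le_mul_of_nonneg_left this hB]

lemma SmoothBounded.memS {M : ℕ} {U V : (Fin M → ℝ) → ℝ} {F : (Fin M → ℝ) → ℂ}
    (hU : TameWeight U) (hV : TameWeight V) (hF : SmoothBounded F) (hFU : ExpDecay U F)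
    (hFV : ExpDecay V (FT F)) : MemS U V F := by
  have hFT := hFU.smoothBounded_FT hU hF.contDiff.continuous
  exact ⟨hFU.integrable hU hF.contDiff.continuous, hF.contDiff, hFT.contDiff,
    fun lam hlam α => (hF.expDecay_pDpow hU hFU α).supNorm_lt_top hlam.le,
    fun lam hlam α => (hFT.expDecay_pDpow hV hFV α).supNorm_lt_top hlam.le⟩

/-- For `f, g ∈ S_Ω^Σ(ℝ^N)`, the short-time Fourier transform `V_g f` belongs
to `S_{Ω⊕Σ}^{Σ⊕Ω}(ℝ^{2N})` (Remark 3.1 of the paper). -/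
theorem statement_10 (N : ℕ) (ω σ : Fin N → ℝ → ℝ)
    (hω : ∀ j, IsWeightFun (ω j)) (hσ : ∀ j, IsWeightFun (σ j))
    (f g : (Fin N → ℝ) → ℂ)
    (hf : MemS (wSum ω) (wSum σ) f) (hg : MemS (wSum ω) (wSum σ) g) :
    MemS (M := N + N)
      (fun z => (∑ j, ω j (firstB z j)) + ∑ j, σ j (secondB z j))
      (fun z => (∑ j, σ j (firstB z j)) + ∑ j, ω j (secondB z j))
      (fun z => STFT g f (firstB z) (secondB z)) := by
  have hOm : TameWeight (wSum ω) := tameWeight_wSum hω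
  have hSig : TameWeight (wSum σ) := tameWeight_wSum hσ
  have hdecay : ∀ {h}, MemS (wSum ω) (wSum σ) h → ExpDecay (wSum ω) h := fun {h} H =>
    .of_supNorm hOm.nonneg fun lam hlam => by simpa only [Dpow_zero] using H.decay lam hlam 0
  have hdecay' : ∀ {h}, MemS (wSum ω) (wSum σ) h → ExpDecay (wSum σ) (FT h) := fun {h} H =>
    .of_supNorm hSig.nonneg fun lam hlam => by simpa only [Dpow_zero] using H.decay_ft lam hlam 0
  have hfc := hf.smooth.continuous
  have hGc := hg.smooth_ft.continuous
  have hGi : Integrable (FT g) := (hdecay' hg).integrable hSig hGc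
  have hsymc := continuous_stftSymbol hfc hGc
  have hsym := (hdecay hf).stftSymbol hSig (hdecay' hg)
  have hW := hOm.directSum hSig
  have hW' := hSig.directSum hOm
  have heq : (fun z => STFT g f (firstB z) (secondB z)) = FT (stftSymbol g f) :=
    funext fun z =>
      (FT_stftSymbol hfc hf.integrable hg.smooth.continuous hg.integrable hGc hGi z).symm
  have htime : ExpDecay (fun z => wSum ω (firstB z)) (FT (stftSymbol g f)) := by
    intro lam hlam
    obtain ⟨C, hC, h⟩ := (hdecay hf).integral_norm_mul_norm_sub_le hOm (hdecay hg) hlam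
    exact ⟨C, hC, fun z => by
      rw [← heq]; exact (norm_STFT_le_time g f _ _).trans (h _)⟩
  have hfreq : ExpDecay (fun z => wSum σ (secondB z)) (FT (stftSymbol g f)) := by
    intro lam hlam
    obtain ⟨C, hC, h⟩ := ((hdecay' hg).comp_neg hSig).integral_norm_mul_norm_sub_le hSig
      ((hdecay' hf).comp_neg hSig) hlam
    refine ⟨‖((2 * Real.pi : ℂ) ^ N)⁻¹‖ * C, by positivity, fun z => ?_⟩
    rw [mul_assoc]
    exact (norm_FT_stftSymbol_le_frequency hfc hf.integrable hGc hGi z).trans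
      (mul_le_mul_of_nonneg_left (h _) (norm_nonneg _))
  have hF := htime.directSum hfreq
  have hFs := hsym.smoothBounded_FT hW' hsymc
  have hFF : FT (FT (stftSymbol g f)) =
      fun w => (2 * Real.pi : ℂ) ^ (N + N) * stftSymbol g f (-w) :=
    funext fun w => FT_FT hsymc (hsym.integrable hW' hsymc)
      (hF.integrable hW hFs.contDiff.continuous) w
  rw [heq]
  refine hFs.memS hW hW' hF ?_
  rw [hFF]
  exact (hsym.comp_neg hW').const_mul _

end
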